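/- arXiv:2411.13972 — 4 statements merged into one kernel-verified Lean document; each statement's English description precedes it below -/
import Mathlib

section
/- Fix a > 0 and x₀ < 0. As β → 0⁺, the functions s'_β converge uniformly on the interval [x₀, 0] to the function s'(x) = e^{−a x/2}. -/
/-- The derivative `s'_β(u) = exp(-2 ∫₀ᵘ (1/4)(a - e^{v/β}) dv)` of the scale function. -/
noncomputable def scaleDeriv (a β u : ℝ) : ℝ :=
  Real.exp (-2 * ∫ v in (0 : ℝ)..u, (1 / 4) * (a - Real.exp (v / β)))

theorem scaleDeriv_eq_exp_mul_exp (a u : ℝ) {β : ℝ} (hβ : β ≠ 0) :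
    scaleDeriv a β u =
      Real.exp (-a * u / 2) * Real.exp (β / 2 * (Real.exp (u / β) - 1)) := by
  have hint : IntervalIntegrable (fun v => Real.exp (v / β)) MeasureTheory.volume 0 u :=
    Continuous.intervalIntegrable (by fun_prop) _ _
  have hexp : ∫ v in (0 : ℝ)..u, Real.exp (v / β) = β * (Real.exp (u / β) - 1) := by
    rw [intervalIntegral.integral_comp_div Real.exp hβ, integral_exp]
    simp
  rw [scaleDeriv, intervalIntegral.integral_const_mul,
    intervalIntegral.integral_sub intervalIntegrable_const hint, hexp, ← Real.exp_add,
    intervalIntegral.integral_const]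
  congr 1
  simp only [smul_eq_mul]
  ring

theorem abs_exp_sub_scaleDeriv_le (a : ℝ) {β u : ℝ} (hβ : 0 < β) (hu : u ≤ 0) :
    |Real.exp (-a * u / 2) - scaleDeriv a β u| ≤ Real.exp (-a * u / 2) * (β / 2) := by
  have hle : Real.exp (u / β) ≤ 1 :=
    Real.exp_le_one_iff.2 (div_nonpos_of_nonpos_of_nonneg hu hβ.le)
  have hδ : β / 2 * (Real.exp (u / β) - 1) ≤ 0 :=
    mul_nonpos_of_nonneg_of_nonpos (by positivity) (by linarith)
  have hδ' : -(β / 2) ≤ β / 2 * (Real.exp (u / β) - 1) := by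
    nlinarith [mul_pos hβ (Real.exp_pos (u / β))]
  rw [scaleDeriv_eq_exp_mul_exp a u hβ.ne', ← mul_one_sub, abs_mul, Real.abs_exp,
    abs_of_nonneg (sub_nonneg.2 (Real.exp_le_one_iff.2 hδ))]
  gcongr
  linarith [Real.add_one_le_exp (β / 2 * (Real.exp (u / β) - 1))]

/-- as `β → 0⁺`, `s'_β` converges uniformly on `[x₀, 0]` to `s'(x) = e^{-a x/2}`. -/
theorem scaleDeriv_tendstoUniformlyOn (a x₀ : ℝ) (ha : 0 < a) (hx₀ : x₀ < 0) :
    TendstoUniformlyOn (fun β x => scaleDeriv a β x) (fun x => Real.exp (-a * x / 2))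
      (nhdsWithin 0 (Set.Ioi 0)) (Set.Icc x₀ 0) := by
  rw [Metric.tendstoUniformlyOn_iff]
  intro ε hε
  have hlim : Filter.Tendsto (fun β : ℝ => Real.exp (-a * x₀ / 2) * (β / 2))
      (nhdsWithin 0 (Set.Ioi 0)) (nhds 0) := by
    refine Filter.Tendsto.mono_left ?_ nhdsWithin_le_nhds
    exact Continuous.tendsto' (by fun_prop) _ _ (by simp)
  filter_upwards [hlim.eventually_lt_const hε, self_mem_nhdsWithin] with β hβε hβ x hx
  have hβ : 0 < β := hβ
  rw [Real.dist_eq]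
  refine ((abs_exp_sub_scaleDeriv_le a hβ hx.2).trans ?_).trans_lt hβε
  gcongr ?_ * _
  exact Real.exp_le_exp.2 (by nlinarith [hx.1])
end

section
/- Fix a > 0 and x₀ < 0. As β → 0⁺, the scale functions s_β converge uniformly on the interval [x₀, 0] to the limiting scale function s(x) = (2/a)(e^{a/2} − e^{−a x/2}). -/
/-- The scale function `s_β(x) = ∫_{-1}^{x} exp(-2 ∫₀ᵘ (1/4)(a - e^{v/β}) dv) du`. -/
noncomputable def scaleFun (a β x : ℝ) : ℝ :=
  ∫ u in (-1 : ℝ)..x, Real.exp (-2 * ∫ v in (0 : ℝ)..u, (1 / 4) * (a - Real.exp (v / β)))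

theorem integral_drift (a β u : ℝ) (hβ : β ≠ 0) :
    ∫ v in (0 : ℝ)..u, (1 / 4) * (a - Real.exp (v / β)) =
      (1 / 4) * (a * u - β * (Real.exp (u / β) - 1)) := by
  have h : Continuous fun v : ℝ => Real.exp (v / β) := by fun_prop
  rw [intervalIntegral.integral_const_mul,
    intervalIntegral.integral_sub (by simp) (h.intervalIntegrable _ _),
    intervalIntegral.integral_comp_div _ hβ]
  simp [integral_exp, mul_comm]

theorem integral_exp_neg_mul_div_two (a x : ℝ) (ha : a ≠ 0) :
    ∫ u in (-1 : ℝ)..x, Real.exp (-a * u / 2) =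
      (2 / a) * (Real.exp (a / 2) - Real.exp (-a * x / 2)) := by
  have h : ∀ u : ℝ, -a * u / 2 = (-a / 2) * u := fun u => by ring
  have hc : -a / 2 ≠ 0 := by simpa using ha
  simp_rw [h]
  rw [intervalIntegral.integral_comp_mul_left (fun u => Real.exp u) hc, integral_exp, smul_eq_mul,
    show -a / 2 * -1 = a / 2 by ring]
  field_simp
  ring

theorem abs_exp_scale_sub_le (a β u : ℝ) (hβ : 0 < β) (hu : u ≤ 0) :
    |Real.exp (-2 * ((1 / 4) * (a * u - β * (Real.exp (u / β) - 1)))) - Real.exp (-a * u / 2)| ≤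
      Real.exp (-a * u / 2) * (β / 2) := by
  set t := β / 2 * (Real.exp (u / β) - 1) with ht
  have hexp : Real.exp (u / β) ≤ 1 := Real.exp_le_one_iff.2
    (div_nonpos_of_nonpos_of_nonneg hu hβ.le)
  have ht0 : t ≤ 0 := mul_nonpos_of_nonneg_of_nonpos (by positivity) (by linarith)
  have ht1 : -(β / 2) ≤ t := by
    have := mul_pos (half_pos hβ) (Real.exp_pos (u / β))
    rw [ht]; linarith
  rw [show -2 * ((1 / 4) * (a * u - β * (Real.exp (u / β) - 1))) = -a * u / 2 + t by
      rw [ht]; ring,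
    Real.exp_add, ← mul_sub_one, abs_mul, Real.abs_exp]
  gcongr
  rw [abs_le]
  constructor
  · linarith [Real.add_one_le_exp t]
  · linarith [Real.exp_le_one_iff.2 ht0]

theorem abs_scaleFun_sub_le (a β x₀ x : ℝ) (ha : 0 < a) (hβ : 0 < β) (hx : x ∈ Set.Icc x₀ 0) :
    |scaleFun a β x - (2 / a) * (Real.exp (a / 2) - Real.exp (-a * x / 2))| ≤
      Real.exp (a * (1 - x₀) / 2) * (β / 2) * (1 - x₀) := by
  obtain ⟨hx0, hx1⟩ := hx
  have hc : Continuous fun u : ℝ =>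
      Real.exp (-2 * ((1 / 4) * (a * u - β * (Real.exp (u / β) - 1)))) := by fun_prop
  have hc' : Continuous fun u : ℝ => Real.exp (-a * u / 2) := by fun_prop
  rw [← integral_exp_neg_mul_div_two a x ha.ne', scaleFun]
  simp_rw [integral_drift a β _ hβ.ne']
  rw [← intervalIntegral.integral_sub (hc.intervalIntegrable _ _) (hc'.intervalIntegrable _ _),
    ← Real.norm_eq_abs]
  refine (intervalIntegral.norm_integral_le_of_norm_le_const
    (C := Real.exp (a * (1 - x₀) / 2) * (β / 2)) fun u hu => ?_).trans ?_
  · have hu0 : u ≤ 0 := hu.2.trans (max_le (by norm_num) hx1)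
    have hu1 : x₀ - 1 ≤ u := (le_min (by linarith) (by linarith)).trans hu.1.le
    refine (abs_exp_scale_sub_le a β u hβ hu0).trans ?_
    refine mul_le_mul_of_nonneg_right (Real.exp_le_exp.2 ?_) (by positivity)
    nlinarith
  · gcongr
    rw [abs_le]
    constructor <;> linarith

/-- as `β → 0⁺`, the scale functions `s_β` converge uniformly on `[x₀, 0]` to the
limiting scale function `s(x) = (2/a)(e^{a/2} - e^{-a x/2})`. -/
theorem scaleFun_tendstoUniformlyOn (a x₀ : ℝ) (ha : 0 < a) (hx₀ : x₀ < 0) :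
    TendstoUniformlyOn (fun β x => scaleFun a β x)
      (fun x => (2 / a) * (Real.exp (a / 2) - Real.exp (-a * x / 2)))
      (nhdsWithin 0 (Set.Ioi 0)) (Set.Icc x₀ 0) := by
  rw [Metric.tendstoUniformlyOn_iff]
  intro ε hε
  have hlim : Filter.Tendsto
      (fun β : ℝ => Real.exp (a * (1 - x₀) / 2) * (β / 2) * (1 - x₀))
      (nhdsWithin 0 (Set.Ioi 0)) (nhds 0) := by
    have h : Continuous fun β : ℝ => Real.exp (a * (1 - x₀) / 2) * (β / 2) * (1 - x₀) := by
      fun_prop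
    simpa using (h.tendsto 0).mono_left nhdsWithin_le_nhds
  filter_upwards [hlim.eventually_lt_const hε, self_mem_nhdsWithin] with β hβε hβ x hx
  rw [dist_comm, Real.dist_eq]
  exact (abs_scaleFun_sub_le a β x₀ x ha hβ hx).trans_lt hβε
end

section
/- Fix a > 0. There exists β₀ > 0 such that for all β ∈ (0, β₀]: s'_β is increasing on [β^{3/4}, β^{1/6}] and s_β(β^{1/6}) ≥ (β^{1/6} − β^{3/4}) · s'_β(β^{3/4}); moreover (β^{1/6} − β^{3/4}) · s'_β(β^{3/4}) → ∞ as β → 0⁺. -/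
open Filter Topology

theorem scaleDeriv_eq {a β : ℝ} (hβ : β ≠ 0) (u : ℝ) :
    scaleDeriv a β u = Real.exp (-(a / 2) * u + β / 2 * (Real.exp (u / β) - 1)) := by
  have hexp : ∫ v in (0 : ℝ)..u, Real.exp (v / β) = β * (Real.exp (u / β) - 1) := by
    rw [intervalIntegral.integral_comp_div (fun v => Real.exp v) hβ]
    simp
  have hint : IntervalIntegrable (fun v => Real.exp (v / β)) MeasureTheory.volume 0 u :=
    Continuous.intervalIntegrable (by fun_prop) _ _
  rw [scaleDeriv, intervalIntegral.integral_const_mul,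
    intervalIntegral.integral_sub intervalIntegrable_const hint, hexp]
  simp only [intervalIntegral.integral_const, smul_eq_mul]
  congr 1
  ring

theorem scaleFun_eq_integral_scaleDeriv (a β x : ℝ) :
    scaleFun a β x = ∫ u in (-1 : ℝ)..x, scaleDeriv a β u := rfl

theorem scaleDeriv_pos (a β u : ℝ) : 0 < scaleDeriv a β u := Real.exp_pos _

theorem continuous_scaleDeriv {a β : ℝ} (hβ : β ≠ 0) : Continuous (scaleDeriv a β) := by
  rw [funext (scaleDeriv_eq (a := a) hβ)]
  fun_prop

/-- `s'_β` is increasing to the right of the zero `β log a` of the drift. -/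
theorem monotoneOn_scaleDeriv {a β c : ℝ} (hβ : 0 < β) (hc : a ≤ Real.exp (c / β)) :
    MonotoneOn (scaleDeriv a β) (Set.Ici c) := by
  rw [funext (scaleDeriv_eq (a := a) hβ.ne')]
  refine Real.exp_monotone.comp_monotoneOn ?_
  have hderiv (x : ℝ) : HasDerivAt (fun u => -(a / 2) * u + β / 2 * (Real.exp (u / β) - 1))
      (-(a / 2) + Real.exp (x / β) / 2) x := by
    have h := ((hasDerivAt_id x).const_mul (-(a / 2))).add
      (((((hasDerivAt_id x).div_const β).exp).sub_const 1).const_mul (β / 2))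
    refine h.congr_deriv ?_
    simp only [id]
    field_simp
  refine monotoneOn_of_deriv_nonneg (convex_Ici c) (by fun_prop)
    (fun x _ => (hderiv x).differentiableAt.differentiableWithinAt) fun x hx => ?_
  rw [interior_Ici, Set.mem_Ioi] at hx
  rw [(hderiv x).deriv]
  have : Real.exp (c / β) ≤ Real.exp (x / β) := by gcongr
  linarith

theorem mul_scaleDeriv_le_scaleFun {a β c x : ℝ} (hβ : β ≠ 0) (hc : -1 ≤ c) (hcx : c ≤ x)
    (hmono : MonotoneOn (scaleDeriv a β) (Set.Icc c x)) :
    (x - c) * scaleDeriv a β c ≤ scaleFun a β x := by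
  have hint (y z : ℝ) : IntervalIntegrable (scaleDeriv a β) MeasureTheory.volume y z :=
    (continuous_scaleDeriv hβ).intervalIntegrable y z
  rw [scaleFun_eq_integral_scaleDeriv,
    ← intervalIntegral.integral_add_adjacent_intervals (hint (-1) c) (hint c x)]
  have hleft : 0 ≤ ∫ u in (-1 : ℝ)..c, scaleDeriv a β u :=
    intervalIntegral.integral_nonneg hc fun u _ => (scaleDeriv_pos a β u).le
  have hright : ∫ _ in c..x, scaleDeriv a β c ≤ ∫ u in c..x, scaleDeriv a β u :=
    intervalIntegral.integral_mono_on hcx intervalIntegrable_const (hint c x)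
      fun u hu => hmono (Set.left_mem_Icc.2 hcx) hu hu.1
  rw [intervalIntegral.integral_const, smul_eq_mul] at hright
  linarith

theorem eq_inv_rpow_neg_quarter_pow {β : ℝ} (hβ : 0 < β) :
    β = ((β ^ (-(1 / 4) : ℝ)) ^ 4)⁻¹ := by
  rw [← Real.rpow_natCast, ← Real.rpow_mul hβ.le, ← Real.rpow_neg hβ.le]
  norm_num

theorem rpow_three_quarters_eq {β : ℝ} (hβ : 0 < β) :
    β ^ ((3 : ℝ) / 4) = ((β ^ (-(1 / 4) : ℝ)) ^ 3)⁻¹ := by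
  rw [← Real.rpow_natCast, ← Real.rpow_mul hβ.le, ← Real.rpow_neg hβ.le]
  norm_num

theorem rpow_three_quarters_div {β : ℝ} (hβ : 0 < β) :
    β ^ ((3 : ℝ) / 4) / β = β ^ (-(1 / 4) : ℝ) := by
  rw [← Real.rpow_sub_one hβ.ne']
  norm_num

theorem inv_rpow_neg_quarter_le {β : ℝ} (hβ : 0 < β) (hβ' : β ≤ 1) :
    (β ^ (-(1 / 4) : ℝ))⁻¹ ≤ β ^ ((1 : ℝ) / 6) := by
  rw [← Real.rpow_neg hβ.le]
  exact Real.rpow_le_rpow_of_exponent_ge hβ hβ' (by norm_num)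

theorem tendsto_rpow_neg_quarter :
    Tendsto (fun β : ℝ => β ^ (-(1 / 4) : ℝ)) (𝓝[>] 0) atTop :=
  tendsto_rpow_neg_nhdsGT_zero (by norm_num)

theorem pow_six_le_exp_sub {a t : ℝ} (ha : 0 < a) (ht : 5040 * (5 + a) ≤ t) :
    4 * t ^ 6 ≤ Real.exp t - 1 - a * t := by
  have ht1 : 1 ≤ t := by linarith
  have hexp : t ^ 7 / 5040 ≤ Real.exp t := by
    simpa [Nat.factorial] using Real.pow_div_factorial_le_exp t (by linarith) 7
  have h6 : t ≤ t ^ 6 := le_self_pow₀ ht1 (by norm_num)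
  have h7 : t ^ 6 * (5040 * (5 + a)) ≤ t ^ 6 * t := by gcongr
  have ha6 : a * t ≤ a * t ^ 6 := by gcongr
  have : t ^ 7 = t ^ 6 * t := pow_succ t 6
  linarith

theorem rpow_neg_quarter_le_mul_scaleDeriv {a β : ℝ} (ha : 0 < a) (hβ : 0 < β) (hβ' : β ≤ 1)
    (ht : 5040 * (5 + a) ≤ β ^ (-(1 / 4) : ℝ)) :
    β ^ (-(1 / 4) : ℝ) ≤
      (β ^ ((1 : ℝ) / 6) - β ^ ((3 : ℝ) / 4)) * scaleDeriv a β (β ^ ((3 : ℝ) / 4)) := by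
  have hdiv := rpow_three_quarters_div hβ
  have h34 := rpow_three_quarters_eq hβ
  have h16 := inv_rpow_neg_quarter_le hβ hβ'
  have hβt := eq_inv_rpow_neg_quarter_pow hβ
  rw [scaleDeriv_eq hβ.ne', hdiv, h34]
  set t := β ^ (-(1 / 4) : ℝ)
  have htpos : 0 < t := by linarith
  have hlen : t⁻¹ / 2 ≤ β ^ ((1 : ℝ) / 6) - (t ^ 3)⁻¹ := by
    have : (t ^ 3)⁻¹ ≤ t⁻¹ / 2 := by
      rw [inv_eq_one_div, inv_eq_one_div, div_div, div_le_div_iff₀ (by positivity) (by positivity)]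
      nlinarith [mul_pos htpos htpos]
    linarith
  have hval : 2 * t ^ 2 ≤ Real.exp (-(a / 2) * (t ^ 3)⁻¹ + β / 2 * (Real.exp t - 1)) := by
    refine le_trans ?_ ((lt_add_one _).le.trans (Real.add_one_le_exp _))
    have : -(a / 2) * (t ^ 3)⁻¹ + β / 2 * (Real.exp t - 1)
        = (t ^ 4)⁻¹ / 2 * (Real.exp t - 1 - a * t) := by
      rw [hβt]
      field_simp
      ring
    rw [this]
    calc 2 * t ^ 2 = (t ^ 4)⁻¹ / 2 * (4 * t ^ 6) := by field_simp; norm_num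
      _ ≤ _ := by gcongr; exact pow_six_le_exp_sub ha ht
  calc t = t⁻¹ / 2 * (2 * t ^ 2) := by field_simp
    _ ≤ _ := by gcongr; exact le_trans (by positivity) hlen

/-- for all small enough `β`, `s'_β` is increasing on `[β^{3/4}, β^{1/6}]` and
`s_β(β^{1/6}) ≥ (β^{1/6} - β^{3/4}) s'_β(β^{3/4})`; moreover the right-hand side tends to `∞`
as `β → 0⁺`. -/
theorem scaleFun_lower_bound_blows_up (a : ℝ) (ha : 0 < a) :
    (∃ β₀ : ℝ, 0 < β₀ ∧ ∀ β : ℝ, 0 < β → β ≤ β₀ →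
      MonotoneOn (scaleDeriv a β) (Set.Icc (β ^ ((3 : ℝ) / 4)) (β ^ ((1 : ℝ) / 6))) ∧
      scaleFun a β (β ^ ((1 : ℝ) / 6)) ≥
        (β ^ ((1 : ℝ) / 6) - β ^ ((3 : ℝ) / 4)) * scaleDeriv a β (β ^ ((3 : ℝ) / 4))) ∧
    Filter.Tendsto
      (fun β : ℝ => (β ^ ((1 : ℝ) / 6) - β ^ ((3 : ℝ) / 4)) * scaleDeriv a β (β ^ ((3 : ℝ) / 4)))
      (nhdsWithin 0 (Set.Ioi 0)) Filter.atTop := by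
  have hle_one : ∀ᶠ β : ℝ in 𝓝[>] 0, β ≤ 1 :=
    eventually_nhdsWithin_of_eventually_nhds (eventually_le_nhds one_pos)
  constructor
  · have hev : ∀ᶠ β : ℝ in 𝓝[>] 0, β ≤ 1 ∧ a ≤ β ^ (-(1 / 4) : ℝ) :=
      hle_one.and (tendsto_rpow_neg_quarter.eventually_ge_atTop a)
    obtain ⟨β₀, hβ₀, hsub⟩ := mem_nhdsGT_iff_exists_Ioc_subset.1 hev
    refine ⟨β₀, hβ₀, fun β hβ hle => ?_⟩
    obtain ⟨hβ1, hat⟩ := hsub ⟨hβ, hle⟩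
    have hdrift : a ≤ Real.exp (β ^ ((3 : ℝ) / 4) / β) := by
      rw [rpow_three_quarters_div hβ]
      linarith [Real.add_one_le_exp (β ^ (-(1 / 4) : ℝ))]
    have hmono := (monotoneOn_scaleDeriv hβ hdrift).mono
      (Set.Icc_subset_Ici_self (a := β ^ ((1 : ℝ) / 6)))
    refine ⟨hmono, mul_scaleDeriv_le_scaleFun hβ.ne' ?_ ?_ hmono⟩
    · linarith [Real.rpow_nonneg hβ.le (3 / 4)]
    · exact Real.rpow_le_rpow_of_exponent_ge hβ hβ1 (by norm_num)
  · refine tendsto_atTop_mono' _ ?_ tendsto_rpow_neg_quarter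
    filter_upwards [hle_one, self_mem_nhdsWithin,
      tendsto_rpow_neg_quarter.eventually_ge_atTop (5040 * (5 + a))] with β hβ1 hβ ht
    exact rpow_neg_quarter_le_mul_scaleDeriv ha hβ hβ1 ht
end

section
/- Fix a > 0 and γ < 0. Then the ratio (s_β(γ) − s_β(0)) / (s_β(γ) − s_β(β^{1/6})) tends to 0 as β → 0⁺. (This ratio is the probability that the stationary diffusion started at 0 hits the level β^{1/6} before the level γ, so this limit says that such upcrossings become negligible in the high-temperature limit.) -/
open Filter Topology Set intervalIntegral

/-- The density of the scale function in closed form. -/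
noncomputable def scaleDensity (a β u : ℝ) : ℝ :=
  Real.exp (-(a * u / 2) + β / 2 * (Real.exp (u / β) - 1))

lemma continuous_scaleDensity (a β : ℝ) : Continuous (scaleDensity a β) := by
  unfold scaleDensity
  fun_prop

lemma scaleFun_eq_integral_scaleDensity (a x : ℝ) {β : ℝ} (hβ : β ≠ 0) :
    scaleFun a β x = ∫ u in (-1 : ℝ)..x, scaleDensity a β u := by
  unfold scaleFun scaleDensity
  congr 1 with u
  have h : ∫ v in (0 : ℝ)..u, Real.exp (v / β) = β * (Real.exp (u / β) - 1) := by
    simp [integral_comp_div Real.exp hβ]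
  rw [integral_const_mul, integral_sub (by simp)
    (Continuous.intervalIntegrable (by fun_prop) _ _), h]
  simp only [integral_const, smul_eq_mul]
  ring_nf

lemma scaleFun_sub_scaleFun (a x y : ℝ) {β : ℝ} (hβ : β ≠ 0) :
    scaleFun a β y - scaleFun a β x = ∫ u in x..y, scaleDensity a β u := by
  have hint (p q : ℝ) :=
    (continuous_scaleDensity a β).intervalIntegrable (μ := MeasureTheory.volume) p q
  simp only [scaleFun_eq_integral_scaleDensity _ _ hβ]
  exact integral_interval_sub_left (hint _ _) (hint _ _)

lemma integral_scaleDensity_nonneg (a β : ℝ) {x y : ℝ} (h : x ≤ y) :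
    0 ≤ ∫ u in x..y, scaleDensity a β u :=
  integral_nonneg h fun _ _ => (Real.exp_pos _).le

lemma integral_scaleDensity_le {a β γ : ℝ} (ha : 0 ≤ a) (hβ : 0 < β) (hγ : γ ≤ 0) :
    ∫ u in γ..0, scaleDensity a β u ≤ -γ * Real.exp (-(a * γ / 2)) := by
  have h := integral_mono_on (μ := MeasureTheory.volume) hγ
    ((continuous_scaleDensity a β).intervalIntegrable _ _)
    (g := fun _ => Real.exp (-(a * γ / 2))) (by simp) fun u hu => by
      have h1 : Real.exp (u / β) ≤ 1 :=
        Real.exp_le_one_iff.2 (div_nonpos_of_nonpos_of_nonneg hu.2 hβ.le)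
      have h2 := mul_le_mul_of_nonneg_left hu.1 ha
      refine Real.exp_le_exp.2 ?_
      nlinarith
  simpa using h

lemma le_scaleDensity (a : ℝ) {β u : ℝ} (hβ : 0 < β) (hu : 0 ≤ u) :
    u ^ 2 / (4 * β) - a / 2 * u ≤ scaleDensity a β u := by
  have h1 := Real.quadratic_le_exp_of_nonneg (div_nonneg hu hβ.le)
  have h2 := mul_le_mul_of_nonneg_left h1 (half_pos hβ).le
  have h3 : β / 2 * (1 + u / β + (u / β) ^ 2 / 2) = β / 2 + u / 2 + u ^ 2 / (4 * β) := by
    field_simp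
    ring
  have h4 := Real.add_one_le_exp (-(a * u / 2) + β / 2 * (Real.exp (u / β) - 1))
  unfold scaleDensity
  linarith

lemma le_integral_scaleDensity (a : ℝ) {β x : ℝ} (hβ : 0 < β) (hx : 0 ≤ x) :
    x ^ 3 / (12 * β) - a / 4 * x ^ 2 ≤ ∫ u in (0 : ℝ)..x, scaleDensity a β u := by
  have h := integral_mono_on (μ := MeasureTheory.volume) hx
    (f := fun u => u ^ 2 / (4 * β) - a / 2 * u)
    (Continuous.intervalIntegrable (by fun_prop) _ _)
    ((continuous_scaleDensity a β).intervalIntegrable _ _)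
    fun u hu => le_scaleDensity a hβ hu.1
  rw [integral_sub (Continuous.intervalIntegrable (by fun_prop) _ _)
    (Continuous.intervalIntegrable (by fun_prop) _ _), integral_div, integral_const_mul,
    integral_pow, integral_id] at h
  refine le_trans (le_of_eq ?_) h
  field_simp
  norm_num
  ring

/-- for fixed `a > 0` and `γ < 0`, the ratio
`(s_β(γ) - s_β(0)) / (s_β(γ) - s_β(β^{1/6}))`, which is the probability that the stationary
diffusion started at `0` hits the level `β^{1/6}` before the level `γ`, tends to `0` as
`β → 0⁺`. -/
theorem hitting_probability_tendsto_zero (a γ : ℝ) (ha : 0 < a) (hγ : γ < 0) :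
    Filter.Tendsto
      (fun β : ℝ =>
        (scaleFun a β γ - scaleFun a β 0) / (scaleFun a β γ - scaleFun a β (β ^ ((1 : ℝ) / 6))))
      (nhdsWithin 0 (Set.Ioi 0)) (nhds 0) := by
  have hL : Tendsto (fun β : ℝ => β ^ (-(1 / 2) : ℝ) / 12 - a / 4) (𝓝[>] 0) atTop :=
    tendsto_atTop_add_const_right _ _
      ((tendsto_rpow_neg_nhdsGT_zero (by norm_num)).atTop_div_const (by norm_num))
  refine squeeze_zero_norm' ?_ (hL.const_div_atTop (-γ * Real.exp (-(a * γ / 2))))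
  filter_upwards [hL.eventually_gt_atTop 0, Ioo_mem_nhdsGT (zero_lt_one (α := ℝ))]
    with β hpos ⟨hβ, hβ1⟩
  set x := β ^ ((1 : ℝ) / 6) with hx
  have hx0 : 0 ≤ x := Real.rpow_nonneg hβ.le _
  have hx1 : x ≤ 1 := Real.rpow_le_one hβ.le hβ1.le (by norm_num)
  have hx3 : x ^ 3 / (12 * β) = β ^ (-(1 / 2) : ℝ) / 12 := by
    have : β ^ (-(1 / 2) : ℝ) = x ^ 3 / β := by
      rw [hx, ← Real.rpow_mul_natCast hβ.le, ← Real.rpow_sub_one hβ.ne']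
      norm_num
    rw [this]
    field_simp
  have hlow := le_integral_scaleDensity a hβ hx0
  have hx2 : a / 4 * x ^ 2 ≤ a / 4 :=
    mul_le_of_le_one_right (by positivity) (pow_le_one₀ hx0 hx1)
  have hnum := scaleFun_sub_scaleFun a γ 0 hβ.ne'
  have hden := scaleFun_sub_scaleFun a 0 x hβ.ne'
  have hnonneg := integral_scaleDensity_nonneg a β hγ.le
  have hup := integral_scaleDensity_le ha.le hβ hγ.le
  rw [← neg_div_neg_eq, neg_sub, neg_sub, Real.norm_eq_abs, abs_of_nonneg]
  · exact div_le_div₀ (by linarith) (by linarith) hpos (by linarith)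
  · exact div_nonneg (by linarith) (by linarith)
end
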